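/- Let f : X₁ → X₂ be an L-morphism between L-spaces. If f is proper and X₁ is an algebraic L-space, then f is coherent. -/

import Mathlib

open Set Topology

/-- Clopen upsets of a topological space with a partial order. -/
def ClopUp (X : Type*) [TopologicalSpace X] [Preorder X] : Set (Set X) :=
  {U | IsClopen U ∧ IsUpperSet U}

/-- Downward closure of a set. -/
def downClosure (X : Type*) [Preorder X] (A : Set X) : Set X := {x | ∃ y ∈ A, x ≤ y}

/-- Priestley space: compact, and clopen upsets separate points via the Priestley separation axiom. -/
def IsPriestley (X : Type*) [TopologicalSpace X] [Preorder X] : Prop :=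
  CompactSpace X ∧ ∀ x y : X, ¬x ≤ y → ∃ U ∈ ClopUp X, x ∈ U ∧ y ∉ U

/-- Esakia space: a Priestley space in which downward closures of clopens are clopen. -/
def IsEsakia (X : Type*) [TopologicalSpace X] [Preorder X] : Prop :=
  IsPriestley X ∧ ∀ U : Set X, IsClopen U → IsClopen (downClosure X U)

/-- L-space: an extremally order-disconnected Esakia space. -/
def IsLSpace (X : Type*) [TopologicalSpace X] [Preorder X] : Prop :=
  IsEsakia X ∧ ∀ U : Set X, IsOpen U → IsUpperSet U → IsOpen (closure U)

/-- The spatial part of an L-space: points with clopen downset. -/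
def spatialPart (X : Type*) [TopologicalSpace X] [Preorder X] : Set X :=
  {y : X | IsClopen {x : X | x ≤ y}}

/-- Scott upset: a closed upset all of whose minimal points lie in the spatial part. -/
def IsScottUpset (X : Type*) [TopologicalSpace X] [Preorder X] (F : Set X) : Prop :=
  IsClosed F ∧ IsUpperSet F ∧ ∀ y ∈ F, (∀ z ∈ F, z ≤ y → z = y) → y ∈ spatialPart X

/-- Clopen Scott upsets. -/
def ClopSUp (X : Type*) [TopologicalSpace X] [Preorder X] : Set (Set X) :=
  {U | IsClopen U ∧ IsScottUpset X U}

/-- Clopen bisets (both upsets and downsets). -/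
def ClopBi (X : Type*) [TopologicalSpace X] [Preorder X] : Set (Set X) :=
  {U | IsClopen U ∧ IsUpperSet U ∧ IsLowerSet U}

/-- `V ≪ U` for clopen upsets: every open upset whose closure contains `U` contains `V`. -/
def wayBelowSet (X : Type*) [TopologicalSpace X] [Preorder X] (V U : Set X) : Prop :=
  ∀ W : Set X, IsOpen W → IsUpperSet W → U ⊆ closure W → V ⊆ W

/-- The kernel of a clopen upset. -/
def kerSet (X : Type*) [TopologicalSpace X] [Preorder X] (U : Set X) : Set X :=
  ⋃₀ {V | V ∈ ClopUp X ∧ wayBelowSet X V U}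

/-- The core of a clopen upset. -/
def coreSet (X : Type*) [TopologicalSpace X] [Preorder X] (U : Set X) : Set X :=
  ⋃₀ {V | V ∈ ClopSUp X ∧ V ⊆ U}

/-- The regular part of a clopen upset. -/
def regSet (X : Type*) [TopologicalSpace X] [Preorder X] (U : Set X) : Set X :=
  ⋃₀ {V | V ∈ ClopUp X ∧ downClosure X V ⊆ U}

/-- The center of a clopen upset. -/
def cenSet (X : Type*) [TopologicalSpace X] [Preorder X] (U : Set X) : Set X :=
  ⋃₀ {V | V ∈ ClopBi X ∧ V ⊆ U}

/-- The topology on the spatial part, generated by traces of clopen upsets. -/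
def spatialTop (X : Type*) [TopologicalSpace X] [Preorder X] :
    TopologicalSpace (spatialPart X) :=
  TopologicalSpace.generateFrom
    {V : Set (spatialPart X) | ∃ U ∈ ClopUp X, V = ((↑) : spatialPart X → X) ⁻¹' U}

/-- An algebraic L-space: the core of every clopen upset is dense in it. -/
def IsAlgebraicLSpace (X : Type*) [TopologicalSpace X] [Preorder X] : Prop :=
  IsLSpace X ∧ ∀ U ∈ ClopUp X, U ⊆ closure (coreSet X U)

/-- A space is compactly based if compact open sets form a basis. -/
def CompactlyBased (Y : Type*) [TopologicalSpace Y] : Prop :=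
  ∀ V : Set Y, IsOpen V → ∀ y ∈ V, ∃ K : Set Y, IsOpen K ∧ IsCompact K ∧ y ∈ K ∧ K ⊆ V

/-- A set is saturated if it is the intersection of the open sets containing it. -/
def IsSaturatedSet {Y : Type*} [TopologicalSpace Y] (K : Set Y) : Prop :=
  K = ⋂₀ {U : Set Y | IsOpen U ∧ K ⊆ U}

/-- The way-below relation in a frame. -/
def frameWayBelow {L : Type*} [Order.Frame L] (a b : L) : Prop :=
  ∀ S : Set L, b ≤ sSup S → ∃ T : Set L, T ⊆ S ∧ T.Finite ∧ a ≤ sSup T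

/-- A compact element of a frame. -/
def IsCompactElt {L : Type*} [Order.Frame L] (a : L) : Prop := frameWayBelow a a

/-- An algebraic frame: every element is the join of the compact elements below it. -/
def AlgebraicFrame (L : Type*) [Order.Frame L] : Prop :=
  ∀ a : L, a = sSup {k : L | IsCompactElt k ∧ k ≤ a}

/-- An arithmetic frame: algebraic with stable way-below relation. -/
def ArithmeticFrame (L : Type*) [Order.Frame L] : Prop :=
  AlgebraicFrame L ∧
    ∀ a b c : L, frameWayBelow a b → frameWayBelow a c → frameWayBelow a (b ⊓ c)

/-- A coherent frame: arithmetic and compact. -/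
def CoherentFrame (L : Type*) [Order.Frame L] : Prop :=
  ArithmeticFrame L ∧ IsCompactElt (⊤ : L)

/-- A prime filter of a frame. -/
def IsPrimeFilter {L : Type*} [Order.Frame L] (F : Set L) : Prop :=
  F.Nonempty ∧ F ≠ Set.univ ∧ (∀ a ∈ F, ∀ b : L, a ≤ b → b ∈ F) ∧
    (∀ a ∈ F, ∀ b ∈ F, a ⊓ b ∈ F) ∧ ∀ a b : L, a ⊔ b ∈ F → a ∈ F ∨ b ∈ F

/-- A completely prime filter of a frame. -/
def IsCompletelyPrimeFilter {L : Type*} [Order.Frame L] (F : Set L) : Prop :=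
  F.Nonempty ∧ F ≠ Set.univ ∧ (∀ a ∈ F, ∀ b : L, a ≤ b → b ∈ F) ∧
    (∀ a ∈ F, ∀ b ∈ F, a ⊓ b ∈ F) ∧ ∀ S : Set L, sSup S ∈ F → ∃ s ∈ S, s ∈ F

/-- The Priestley space of a frame: prime filters ordered by inclusion. -/
abbrev PriestleyDual (L : Type*) [Order.Frame L] : Type _ := {F : Set L // IsPrimeFilter F}

/-- The Priestley topology on the Priestley space of a frame. -/
instance PriestleyDual.instTopologicalSpace (L : Type*) [Order.Frame L] :
    TopologicalSpace (PriestleyDual L) :=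
  TopologicalSpace.generateFrom
    ({S : Set (PriestleyDual L) | ∃ a : L, S = {x | a ∈ x.val}} ∪
     {S : Set (PriestleyDual L) | ∃ a : L, S = {x | a ∈ x.val}ᶜ})

/-- In a Priestley space, principal downsets are closed. -/
theorem IsPriestley.isClosed_Iic {X : Type*} [TopologicalSpace X] [PartialOrder X]
    (hX : IsPriestley X) (a : X) : IsClosed (Iic a) := by
  rw [← isOpen_compl_iff, isOpen_iff_forall_mem_open]
  intro x hx
  obtain ⟨U, hU, hxU, haU⟩ := hX.2 x a hx
  exact ⟨U, fun y hy hya => haU (hU.2 hya hy), hU.1.isOpen, hxU⟩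

/-- In a Priestley space, every point of a closed set lies above a minimal point of that set. -/
theorem IsPriestley.exists_minimal_le {X : Type*} [TopologicalSpace X] [PartialOrder X]
    (hX : IsPriestley X) {F : Set X} (hF : IsClosed F) {x : X} (hx : x ∈ F) :
    ∃ m ≤ x, Minimal (· ∈ F) m := by
  have := hX.1
  refine zorn_le_nonempty₀ (α := Xᵒᵈ) F (fun (c : Set X) hcF hc y hy => ?_) x hx
  have hclosed : ∀ z : X, IsClosed (F ∩ Iic z) := fun z => hF.inter (hX.isClosed_Iic z)
  have : Nonempty c := ⟨⟨y, hy⟩⟩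
  obtain ⟨m, hm⟩ := IsCompact.nonempty_iInter_of_directed_nonempty_isCompact_isClosed
    (fun z : c => F ∩ Iic z.1)
    (fun a b => by
      rcases hc.total a.2 b.2 with h | h
      · exact ⟨b, fun p hp => ⟨hp.1, le_trans (α := X) hp.2 h⟩, subset_rfl⟩
      · exact ⟨a, subset_rfl, fun p hp => ⟨hp.1, le_trans (α := X) hp.2 h⟩⟩)
    (fun z => ⟨z, hcF z.2, le_refl (α := X) z⟩)
    (fun z => (hclosed z).isCompact) (fun z => hclosed z)
  rw [mem_iInter] at hm
  exact ⟨m, (hm ⟨y, hy⟩).1, fun z hz => (hm ⟨z, hz⟩).2⟩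

/-- In a Priestley space, every Scott upset is way below itself. -/
theorem IsScottUpset.wayBelowSet_self {X : Type*} [TopologicalSpace X] [PartialOrder X]
    (hX : IsPriestley X) {V : Set X} (hV : IsScottUpset X V) : wayBelowSet X V V := by
  intro W _ hWup hVW x hx
  obtain ⟨m, hmx, hm⟩ := hX.exists_minimal_le hV.1 hx
  have hmY : m ∈ spatialPart X :=
    hV.2.2 m hm.prop fun z hz hzm => hzm.antisymm (hm.le_of_le hz hzm)
  obtain ⟨z, hzm, hzW⟩ := mem_closure_iff.1 (hVW hm.prop) _ hmY.isOpen (le_refl m)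
  exact hWup (le_trans hzm hmx) hzW

theorem isOpen_coreSet {X : Type*} [TopologicalSpace X] [Preorder X] (U : Set X) :
    IsOpen (coreSet X U) :=
  isOpen_sUnion fun _ hV => hV.1.1.isOpen

theorem isUpperSet_coreSet {X : Type*} [TopologicalSpace X] [Preorder X] (U : Set X) :
    IsUpperSet (coreSet X U) :=
  isUpperSet_sUnion fun _ hV => hV.1.2.2.1

theorem coreSet_mono {X : Type*} [TopologicalSpace X] [Preorder X] {U V : Set X} (h : U ⊆ V) :
    coreSet X U ⊆ coreSet X V :=
  sUnion_subset_sUnion fun _ hW => ⟨hW.1, hW.2.trans h⟩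

/-- If the core of `U` is dense in `U`, then the kernel of `U` is contained in its core. -/
theorem kerSet_subset_coreSet {X : Type*} [TopologicalSpace X] [Preorder X] {U : Set X}
    (h : U ⊆ closure (coreSet X U)) : kerSet X U ⊆ coreSet X U :=
  sUnion_subset fun _ hV => hV.2 _ (isOpen_coreSet U) (isUpperSet_coreSet U) h

/-- a proper L-morphism with algebraic domain is coherent. -/
theorem stmt4 {X₁ : Type*} [TopologicalSpace X₁] [PartialOrder X₁]
    {X₂ : Type*} [TopologicalSpace X₂] [PartialOrder X₂]
    (hX₁ : IsLSpace X₁) (hX₂ : IsLSpace X₂) (f : X₁ → X₂)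
    (hcont : Continuous f) (hmono : Monotone f)
    (hLmor : ∀ U : Set X₂, IsOpen U → IsUpperSet U → f ⁻¹' closure U = closure (f ⁻¹' U))
    (hproper : ∀ U ∈ ClopUp X₂, f ⁻¹' kerSet X₂ U ⊆ kerSet X₁ (f ⁻¹' U))
    (halg : ∀ U ∈ ClopUp X₁, U ⊆ closure (coreSet X₁ U)) :
    ∀ U ∈ ClopUp X₂, f ⁻¹' coreSet X₂ U ⊆ coreSet X₁ (f ⁻¹' U) := by
  rintro U - x ⟨V, ⟨hV, hVU⟩, hxV⟩
  have hVup : V ∈ ClopUp X₂ := ⟨hV.1, hV.2.2.1⟩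
  have hpre : f ⁻¹' V ∈ ClopUp X₁ := ⟨hV.1.preimage hcont, hVup.2.preimage hmono⟩
  have hxker : x ∈ f ⁻¹' kerSet X₂ V := ⟨V, ⟨hVup, hV.2.wayBelowSet_self hX₂.1.1⟩, hxV⟩
  exact coreSet_mono (preimage_mono hVU)
    (kerSet_subset_coreSet (halg _ hpre) (hproper V hVup hxker))
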